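/- (Backward greedy is Nash stable) Suppose agents 1,…,n with x_1 ≤ … ≤ x_n are allocated by the backward greedy algorithm: fill taxi 1 (capacity q_1) with the q_1 furthest agents, then taxi 2 with the next q_2 furthest, etc. If this produces a feasible allocation 𝒯, then 𝒯 is Nash stable: no agent a ∈ T_i satisfies φ(T_j + a, x_a) < φ(T_i, x_a) for any j ≠ i with |T_j| < q_j. -/

import Mathlib

open Finset MeasureTheory ENNReal

/-- Number of agents in coalition `T` whose destination is at least `r`. -/
noncomputable def nT (xd : ℕ → ℝ) (T : Finset ℕ) (r : ℝ) : ℕ := (T.filter fun a => r ≤ xd a).card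

/-- Shapley cost share of a passenger dropping at `y` in coalition `T`
(`∞` when `n_T` vanishes on part of `(0,y]`). -/
noncomputable def phi (xd : ℕ → ℝ) (T : Finset ℕ) (y : ℝ) : ℝ≥0∞ :=
  ∫⁻ r in Set.Ioc (0:ℝ) y, (nT xd T r : ℝ≥0∞)⁻¹

/-- Cost share including the capacity constraint of the taxi. -/
noncomputable def taxiCost (xd : ℕ → ℝ) (q : ℕ) (T : Finset ℕ) (y : ℝ) : ℝ≥0∞ :=
  if T.card ≤ q then phi xd T y else ⊤

/-- Total capacity of taxis `1, …, i`. -/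
def cumQ (q : ℕ → ℕ) (i : ℕ) : ℕ := ∑ j ∈ Finset.Icc 1 i, q j

/-- The backward greedy allocation for agents `1, …, n` sorted nondecreasingly:
taxi `1` gets the `q 1` furthest agents, taxi `2` the next `q 2` furthest, etc. -/
def greedyT (n : ℕ) (q : ℕ → ℕ) (i : ℕ) : Finset ℕ :=
  Finset.Icc (max 1 (n + 1 - cumQ q i)) (n - cumQ q (i - 1))

theorem cumQ_mono (q : ℕ → ℕ) {i j : ℕ} (h : i ≤ j) : cumQ q i ≤ cumQ q j := by
  unfold cumQ
  exact Finset.sum_le_sum_of_subset (Finset.Icc_subset_Icc_right h)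

theorem cumQ_step (q : ℕ → ℕ) {i : ℕ} (h : 1 ≤ i) : cumQ q i = cumQ q (i - 1) + q i := by
  obtain ⟨m, rfl⟩ : ∃ m, i = m + 1 := ⟨i - 1, by omega⟩
  unfold cumQ
  simp [Finset.sum_Icc_succ_top]

/-- the backward greedy allocation is Nash stable: no agent can strictly
decrease her cost by unilaterally moving to another taxi with a free seat. -/
theorem stmt13 (n k : ℕ) (x : ℕ → ℝ)
    (hpos : ∀ a ∈ Finset.Icc 1 n, 0 < x a)
    (hmono : ∀ a b, 1 ≤ a → a ≤ b → b ≤ n → x a ≤ x b)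
    (q : ℕ → ℕ) (hq : ∀ i j, 1 ≤ i → i ≤ j → j ≤ k → q j ≤ q i)
    (hfeas : n ≤ cumQ q k) :
    ∀ i ∈ Finset.Icc 1 k, ∀ j ∈ Finset.Icc 1 k, i ≠ j →
      ∀ a ∈ greedyT n q i, (greedyT n q j).card < q j →
        ¬ phi x (greedyT n q j ∪ {a}) (x a) < phi x (greedyT n q i) (x a) := by
  intro i hi j hj hij a ha hcard
  rw [Finset.mem_Icc] at hi hj
  have hsi := cumQ_step q hi.1
  have hsj := cumQ_step q hj.1
  have ha' := ha
  rw [greedyT, Finset.mem_Icc] at ha'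
  have hji : i < j := by
    by_contra hlt
    have h1 : cumQ q j ≤ cumQ q (i - 1) := cumQ_mono q (by omega)
    rw [greedyT, Nat.card_Icc] at hcard
    omega
  have h1 : cumQ q i ≤ cumQ q (j - 1) := cumQ_mono q (by omega)
  have hqij := hq i j hi.1 hji.le hj.2
  rw [not_lt]
  unfold phi
  refine setLIntegral_mono' measurableSet_Ioc fun r hr => ?_
  rw [ENNReal.inv_le_inv, Nat.cast_le]
  unfold nT
  by_cases hb : ∃ b ∈ greedyT n q j, r ≤ x b
  · obtain ⟨b, hb, hrb⟩ := hb
    rw [greedyT, Finset.mem_Icc] at hb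
    have hfull : (greedyT n q i).filter (fun a => r ≤ x a) = greedyT n q i := by
      refine Finset.filter_true_of_mem fun c hc => ?_
      rw [greedyT, Finset.mem_Icc] at hc
      exact hrb.trans (hmono b c (by omega) (by omega) (by omega))
    have hci : (greedyT n q i).card = q i := by
      rw [greedyT, Nat.card_Icc]
      omega
    rw [hfull, hci]
    have h2 := Finset.card_filter_le (greedyT n q j ∪ {a}) (fun a => r ≤ x a)
    have h3 := Finset.card_union_le (greedyT n q j) {a}
    rw [Finset.card_singleton] at h3
    omega
  · push Not at hb
    apply Finset.card_le_card
    intro c hc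
    rw [Finset.mem_filter, Finset.mem_union, Finset.mem_singleton] at hc
    rcases hc with ⟨hc | rfl, hrc⟩
    · exact absurd hrc (not_le.mpr (hb c hc))
    · exact Finset.mem_filter.mpr ⟨ha, hrc⟩
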